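/- There exists p₀ such that for every prime p ≥ p₀ the following holds: for any u ∈ V₁ and w ∈ V₂, the number of triples (e₁, e₂, e₃) of pairwise distinct edges of H for which there exist vertices v₂ ∈ V₂ and v₃ ∈ V₃ with u, v₂, v₃, w pairwise distinct such that {u,v₂} ⊆ e₁, {v₂,v₃} ⊆ e₂, and {v₃,w} ⊆ e₃ is at most 36. (That is, there are at most 36 Berge 3-paths of type (1,2,3,2) with end vertices u and w.) -/

import Mathlib

/-- The conditions required of the set `S₁ ⊆ F_p`. -/
def S1Cond (p : ℕ) (S1 : Set (ZMod p)) : Prop :=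
  ∀ x ∈ S1,
    (2 ≤ x.val ∧ x.val ≤ (p - 1) / 2) ∧
    (∀ w : ZMod p, x ≠ -w ^ 2) ∧
    x ^ 2 - 4 * x + 1 ≠ 0 ∧
    3 * x ≠ 1 ∧ 3 * x ≠ 2 ∧
    10872 * x ^ 5 - 12757 * x ^ 4 + 3369 * x ^ 3 + 2312 * x ^ 2
      - 1176 * x - 144 ≠ 0

/-- `S₂ = F_p \ {0, 1}`. -/
def S2set (p : ℕ) : Set (ZMod p) := {x | x ≠ 0 ∧ x ≠ 1}

/-- The part `V_i = S₁ × S₂ × S₂ × {i}` of the vertex set. -/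
def Vpart (p : ℕ) (S1 : Set (ZMod p)) (i : ℕ) : Set (ZMod p × ZMod p × ZMod p × ℕ) :=
  {v | v.1 ∈ S1 ∧ v.2.1 ∈ S2set p ∧ v.2.2.1 ∈ S2set p ∧ v.2.2.2 = i}

/-- The triple `e(x₁, x₂, x₃, a)`. -/
def hedge (p : ℕ) (x1 x2 x3 a : ZMod p) : Set (ZMod p × ZMod p × ZMod p × ℕ) :=
  {(x1, x2 * x3 + a, x2 ^ 2 * x3 + a, 1),
   (x2, x3 * x1 + a, x3 ^ 2 * x1 + a, 2),
   (x3, x1 * x2 + a, x1 ^ 2 * x2 + a, 3)}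

/-- The edge set of the hypergraph `H`. -/
def Hedges (p : ℕ) (S1 : Set (ZMod p)) : Set (Set (ZMod p × ZMod p × ZMod p × ℕ)) :=
  {E | ∃ x1 x2 x3 a : ZMod p, x1 ∈ S1 ∧ x2 ∈ S1 ∧ x3 ∈ S1 ∧ a ≠ 0 ∧
    E = hedge p x1 x2 x3 a ∧
    E ⊆ Vpart p S1 1 ∪ Vpart p S1 2 ∪ Vpart p S1 3}

/-- The polynomial expression whose roots contain the middle coordinates `y` of the
paths `(1, 2, 3, 2)`. The parameters are `A = u₃ - u₂`, `B = w₃ - w₂`, `k = u₁ / B`,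
`d = u₂ - w₂`, `u = u₁` and `w = w₁`. -/
def pathPoly {R : Type*} [CommRing R] (A B k d u w y : R) : R :=
  (y * (w * y * (y - 1) ^ 2 - k * A * (A - y * (y - 1))) ^ 2 * (y * (y - 1)) -
      (w * y ^ 3 * (y - 1) ^ 4 - (k * A * (A - y * (y - 1))) ^ 2) *
        ((u - y) * A + d * (y * (y - 1)))) *
    ((y * (w * y * (y - 1) ^ 2 - k * A * (A - y * (y - 1))) ^ 2 * (y * (y - 1)) -
      (w * y ^ 3 * (y - 1) ^ 4 - (k * A * (A - y * (y - 1))) ^ 2) *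
        ((u - y) * A + d * (y * (y - 1)))) -
      y * (y - 1) * ((y * (y - 1)) ^ 2 - k * A * (A - y * (y - 1))) *
        (w * y * (y - 1) ^ 2 - k * A * (A - y * (y - 1)))) -
  B * (w * y ^ 3 * (y - 1) ^ 4 - (k * A * (A - y * (y - 1))) ^ 2) *
    ((y * (y - 1)) ^ 2 - k * A * (A - y * (y - 1))) ^ 2 *
    (w * y * (y - 1) ^ 2 - k * A * (A - y * (y - 1)))

open Polynomial in
lemma card_roots_pathPoly_le {K : Type*} [Field K] [DecidableEq K] {A B k d u w : K}
    (hA : A ≠ 0) (hk : k ≠ 0) (hu : u ≠ 0) (hu1 : u ≠ 1) (hkB : k * B = u) :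
    ∃ s : Finset K, s.card ≤ 36 ∧ ∀ y, pathPoly A B k d u w y = 0 → y ∈ s := by
  set f : K[X] := pathPoly (C A) (C B) (C k) (C d) (C u) (C w) X with hf
  have heval (y : K) : f.eval y = pathPoly A B k d u w y := by
    simp [hf, pathPoly]
  have hdeg : f.natDegree ≤ 36 := by
    rw [hf, pathPoly]
    compute_degree
    norm_num
  have hf0 : f ≠ 0 := by
    intro h
    have h0 : pathPoly A B k d u w 0 = 0 := by rw [← heval, h, eval_zero]
    have h1 : (k * A ^ 2) ^ 4 * A ^ 2 * (u * (u - 1)) = 0 := by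
      rw [← h0, pathPoly]
      linear_combination ((k * A ^ 2) ^ 4 * A ^ 2) * hkB
    simp [hA, hk, hu, sub_eq_zero, hu1] at h1
  refine ⟨f.roots.toFinset, (f.roots.toFinset_card_le.trans f.card_roots').trans hdeg, ?_⟩
  intro y hy
  simp [hf0, heval, hy]

lemma pull_sq_factor {R : Type*} [CommRing R] (y P Q E t D B : R) :
    ((y * P) ^ 2 * t - y * Q * E) * ((y * P) ^ 2 * t - y * Q * E - t * D * (y * P)) -
        B * (y * Q) * D ^ 2 * (y * P) =
      y ^ 2 * ((y * P ^ 2 * t - Q * E) * (y * P ^ 2 * t - Q * E - t * D * P) -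
        B * Q * D ^ 2 * P) := by
  ring

lemma eliminate_quadratic {K : Type*} [Field K] {t P Q D M B z x' : K} (ht : t ≠ 0)
    (hP : P ≠ 0) (hz : z * (t * D * P) = M) (hQ : Q * x' = t ^ 2 * P)
    (hB : z * (z - 1) * x' = B) :
    M * (M - t * D * P) - B * Q * D ^ 2 * P = 0 := by
  apply mul_left_cancel₀ (mul_ne_zero (pow_ne_zero 2 ht) hP)
  rw [← hz, ← hB]
  linear_combination (-(z * (z - 1)) * t ^ 2 * D ^ 2 * P ^ 2) * hQ

lemma path_system_solution {K : Type*} [Field K] {A B k d u w y s x z x' : K}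
    (hB : B ≠ 0) (hkB : k * B = u) (hu : u ≠ 0)
    (hy0 : y ≠ 0) (hy1 : y ≠ 1) (hs0 : s ≠ 0) (hs1 : s ≠ 1) (hx' : x' ≠ 0)
    (hxx' : x ≠ x')
    (h1 : y * (y - 1) * s = A) (h2 : z * (z - 1) * x = s * (s - 1) * u)
    (h3 : x' * (x' - 1) * w = x * (x - 1) * y) (h4 : z * (z - 1) * x' = B)
    (h5 : z * x' + x * y + s * u + d - y * s - z * x - x' * w = 0) :
    let t := y * (y - 1)
    let N := k * A * (A - t)
    let P := w * t ^ 2 - N * y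
    let Q := w * t ^ 4 - N ^ 2 * y
    pathPoly A B k d u w y = 0 ∧ s = A / t ∧ x' = t ^ 2 * P / Q ∧ x = N * x' / t ^ 2 ∧
      z = (P ^ 2 * t - Q * ((u - y) * A + d * t)) / (t * (t ^ 2 - N) * P) := by
  intro t N P Q
  have ht : t ≠ 0 := mul_ne_zero hy0 (sub_ne_zero.2 hy1)
  have hk : k ≠ 0 := by rintro rfl; simp at hkB; exact hu hkB.symm
  have hst : t * s = A := h1
  have hA : A ≠ 0 := hst ▸ mul_ne_zero ht hs0
  have hAt : A - t ≠ 0 := by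
    rw [← hst, show t * s - t = t * (s - 1) by ring]
    exact mul_ne_zero ht (sub_ne_zero.2 hs1)
  have hN : N ≠ 0 := mul_ne_zero (mul_ne_zero hk hA) hAt
  have hx : t ^ 2 * x = N * x' := by
    apply mul_left_cancel₀ hB
    have e1 : B * x = s * (s - 1) * u * x' := by rw [← h4, ← h2]; ring
    calc B * (t ^ 2 * x) = t ^ 2 * (B * x) := by ring
      _ = (t * s) * (t * s - t) * u * x' := by rw [e1]; ring
      _ = B * (N * x') := by rw [hst, ← hkB]; simp only [N]; ring
  have hDN : t ^ 2 - N ≠ 0 := by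
    intro h
    rw [← sub_eq_zero.1 h] at hx
    exact hxx' (mul_left_cancel₀ (pow_ne_zero 2 ht) hx)
  have hQx : Q * x' = t ^ 2 * P := by
    apply mul_left_cancel₀ hx'
    simp only [Q, P]
    linear_combination t ^ 4 * h3 + y * (t ^ 2 * x + N * x' - t ^ 2) * hx
  have hQ : Q ≠ 0 := by
    intro h
    have hP0 : P = 0 := by simpa [h, ht] using hQx.symm
    have : N * y * (t ^ 2 - N) = 0 := by
      simp only [Q, P] at h hP0
      linear_combination h - t ^ 2 * hP0
    simp [hN, hy0, hDN] at this
  have hP : P ≠ 0 := by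
    intro h
    simp [h, hQ, hx'] at hQx
  have hz0 : z * x' * (t ^ 2 - N) * t = x' * P * t - t ^ 2 * ((u - y) * A + d * t) := by
    simp only [P]
    linear_combination t ^ 3 * h5 + t * (z - y) * hx - t ^ 2 * (u - y) * hst
  have hz : z * (t * (t ^ 2 - N) * P) = P ^ 2 * t - Q * ((u - y) * A + d * t) := by
    apply mul_left_cancel₀ (pow_ne_zero 2 ht)
    linear_combination Q * hz0 + (P * t - z * (t ^ 2 - N) * t) * hQx
  have hL : t * (t ^ 2 - N) * P ≠ 0 := by simp [ht, hDN, hP]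
  refine ⟨?_, ?_, ?_, ?_, ?_⟩
  · have key := eliminate_quadratic ht hP hz hQx h4
    have hP' : P = y * (w * y * (y - 1) ^ 2 - N) := by simp only [P, t]; ring
    have hQ' : Q = y * (w * y ^ 3 * (y - 1) ^ 4 - N ^ 2) := by simp only [Q, t]; ring
    rw [hP', hQ', pull_sq_factor] at key
    exact (mul_eq_zero.1 key).resolve_left (pow_ne_zero 2 hy0)
  · rw [eq_div_iff ht, ← hst, mul_comm]
  · rw [eq_div_iff hQ, ← hQx, mul_comm]
  · rw [eq_div_iff (pow_ne_zero 2 ht), ← hx, mul_comm]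
  · rw [eq_div_iff hL, hz]

lemma S1Cond.ne_zero {p : ℕ} {S1 : Set (ZMod p)} (h : S1Cond p S1) {x : ZMod p}
    (hx : x ∈ S1) : x ≠ 0 := by
  rintro rfl
  have := (h 0 hx).1.1
  simp at this

lemma S1Cond.ne_one {p : ℕ} {S1 : Set (ZMod p)} (h : S1Cond p S1) {x : ZMod p}
    (hx : x ∈ S1) : x ≠ 1 := by
  rintro rfl
  have h2 := (h 1 hx).1.1
  have := ZMod.val_one'' (n := p)
  by_cases hp : p = 1
  · subst hp
    simp [Subsingleton.elim (1 : ZMod 1) 0] at h2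
  · have := this hp
    omega

lemma mem_hedge_one {p : ℕ} {x1 x2 x3 a b c d : ZMod p}
    (h : (b, c, d, 1) ∈ hedge p x1 x2 x3 a) :
    b = x1 ∧ c = x2 * x3 + a ∧ d = x2 ^ 2 * x3 + a := by
  simpa [hedge] using h

lemma mem_hedge_two {p : ℕ} {x1 x2 x3 a b c d : ZMod p}
    (h : (b, c, d, 2) ∈ hedge p x1 x2 x3 a) :
    b = x2 ∧ c = x3 * x1 + a ∧ d = x3 ^ 2 * x1 + a := by
  simpa [hedge] using h

lemma mem_hedge_three {p : ℕ} {x1 x2 x3 a b c d : ZMod p}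
    (h : (b, c, d, 3) ∈ hedge p x1 x2 x3 a) :
    b = x3 ∧ c = x1 * x2 + a ∧ d = x1 ^ 2 * x2 + a := by
  simpa [hedge] using h

/-- The three edges of a path `(1, 2, 3, 2)` as a function of the first coordinate `y` of its
second vertex. -/
def pathEdges (p : ℕ) [Fact p.Prime] (u1 u2 A w1 w2 B y : ZMod p) :
    Set (ZMod p × ZMod p × ZMod p × ℕ) × Set (ZMod p × ZMod p × ZMod p × ℕ) ×
      Set (ZMod p × ZMod p × ZMod p × ℕ) :=
  let t := y * (y - 1)
  let N := u1 / B * A * (A - t)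
  let P := w1 * t ^ 2 - N * y
  let Q := w1 * t ^ 4 - N ^ 2 * y
  let s := A / t
  let x' := t ^ 2 * P / Q
  let x := N * x' / t ^ 2
  let z := (P ^ 2 * t - Q * ((u1 - y) * A + (u2 - w2) * t)) / (t * (t ^ 2 - N) * P)
  (hedge p u1 y s (u2 - y * s), hedge p x y z (s * u1 + (u2 - y * s) - z * x),
    hedge p x' w1 z (w2 - z * x'))

theorem stmt_18 :
    ∃ p0 : ℕ, ∀ p : ℕ, p.Prime → p0 ≤ p →
      ∀ S1 : Set (ZMod p), S1Cond p S1 →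
        ∀ u ∈ Vpart p S1 1, ∀ w ∈ Vpart p S1 2,
          {t : Set (ZMod p × ZMod p × ZMod p × ℕ) ×
               Set (ZMod p × ZMod p × ZMod p × ℕ) ×
               Set (ZMod p × ZMod p × ZMod p × ℕ) |
            t.1 ∈ Hedges p S1 ∧ t.2.1 ∈ Hedges p S1 ∧ t.2.2 ∈ Hedges p S1 ∧
            t.1 ≠ t.2.1 ∧ t.1 ≠ t.2.2 ∧ t.2.1 ≠ t.2.2 ∧
            ∃ v2 ∈ Vpart p S1 2, ∃ v3 ∈ Vpart p S1 3,
              [u, v2, v3, w].Pairwise (· ≠ ·) ∧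
              {u, v2} ⊆ t.1 ∧ {v2, v3} ⊆ t.2.1 ∧ {v3, w} ⊆ t.2.2}.encard ≤ 36 := by
  refine ⟨0, fun p hp _ S1 hS u hu w hw => ?_⟩
  have : Fact p.Prime := ⟨hp⟩
  obtain ⟨u1, u2, u3, i⟩ := u
  obtain ⟨w1, w2, w3, j⟩ := w
  obtain ⟨hu1, -, -, rfl⟩ := hu
  obtain ⟨hw1, -, -, rfl⟩ := hw
  dsimp only at hu1 hw1
  have hu0 := hS.ne_zero hu1
  by_cases hAB : u3 - u2 ≠ 0 ∧ w3 - w2 ≠ 0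
  swap
  · refine (Set.encard_eq_zero.2 (Set.eq_empty_iff_forall_notMem.2 ?_)).trans_le bot_le
    rintro ⟨e1, e2, e3⟩ ⟨⟨_, y, s, a, -, hy, hs, -, rfl, -⟩, -,
      ⟨x', _, z, c, hx', -, hz, -, rfl, -⟩, -, -, -, v2, -, v3, -, -, h1, -, h3⟩
    obtain ⟨rfl, ha2, ha3⟩ := mem_hedge_one (h1 (Set.mem_insert _ _))
    obtain ⟨rfl, hc2, hc3⟩ := mem_hedge_two (h3 (Set.mem_insert_of_mem _ rfl))
    apply hAB
    constructor
    · rw [ha2, ha3, show y ^ 2 * s + a - (y * s + a) = y * (y - 1) * s by ring]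
      exact mul_ne_zero (mul_ne_zero (hS.ne_zero hy) (sub_ne_zero.2 (hS.ne_one hy)))
        (hS.ne_zero hs)
    · rw [hc2, hc3, show z ^ 2 * x' + c - (z * x' + c) = z * (z - 1) * x' by ring]
      exact mul_ne_zero (mul_ne_zero (hS.ne_zero hz) (sub_ne_zero.2 (hS.ne_one hz)))
        (hS.ne_zero hx')
  obtain ⟨hA, hB⟩ := hAB
  obtain ⟨r, hr, hroots⟩ := card_roots_pathPoly_le (d := u2 - w2) (w := w1) hA
    (div_ne_zero hu0 hB) hu0 (hS.ne_one hu1) (div_mul_cancel₀ u1 hB)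
  refine (Set.encard_le_encard
    (t := pathEdges p u1 u2 (u3 - u2) w1 w2 (w3 - w2) '' (r : Set (ZMod p))) ?_).trans
    ((Set.encard_image_le _ _).trans ?_)
  · rintro ⟨e1, e2, e3⟩ ⟨⟨_, y, s, a, -, hy, hs, -, rfl, -⟩,
      ⟨x, _, z, b, hx, -, hz, -, rfl, -⟩, ⟨x', _, _, c, hx', -, -, -, rfl, -⟩,
      -, -, hne, ⟨v21, v22, v23, _⟩, ⟨-, -, -, rfl⟩, ⟨v31, v32, v33, _⟩, ⟨-, -, -, rfl⟩,
      -, h1, h2, h3⟩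
    obtain ⟨rfl, ha2, ha3⟩ := mem_hedge_one (h1 (Set.mem_insert _ _))
    obtain ⟨rfl, hb2, hb3⟩ := mem_hedge_two (h1 (Set.mem_insert_of_mem _ rfl))
    obtain ⟨rfl, hc2, hc3⟩ := mem_hedge_two (h2 (Set.mem_insert _ _))
    obtain ⟨rfl, hd2, hd3⟩ := mem_hedge_three (h2 (Set.mem_insert_of_mem _ rfl))
    obtain ⟨rfl, he2, he3⟩ := mem_hedge_three (h3 (Set.mem_insert _ _))
    obtain ⟨rfl, hf2, hf3⟩ := mem_hedge_two (h3 (Set.mem_insert_of_mem _ rfl))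
    have eq3 : x' * (x' - 1) * w1 = x * (x - 1) * v21 := by
      linear_combination he2 - he3 + hd3 - hd2
    have hxx' : x ≠ x' := by
      rintro rfl
      have hyw : w1 = v21 :=
        mul_left_cancel₀ (mul_ne_zero (hS.ne_zero hx) (sub_ne_zero.2 (hS.ne_one hx))) eq3
      subst hyw
      have hbc : b = c := by linear_combination he2 - hd2
      exact hne (by rw [hbc])
    obtain ⟨hroot, hs', hx'', hx3, hz'⟩ := path_system_solution (A := u3 - u2) (B := w3 - w2)
      (k := u1 / (w3 - w2)) (d := u2 - w2) (z := v31) hB (div_mul_cancel₀ u1 hB) hu0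
      (hS.ne_zero hy) (hS.ne_one hy) (hS.ne_zero hs) (hS.ne_one hs) (hS.ne_zero hx') hxx'
      (by linear_combination ha2 - ha3) (by linear_combination hb3 - hb2 + hc2 - hc3) eq3
      (by linear_combination hf2 - hf3)
      (by linear_combination ha2 - hf2 - hb2 + hc2 - hd2 + he2)
    refine ⟨v21, hroots _ hroot, ?_⟩
    simp only [pathEdges]
    rw [← hs', ← hx'', ← hx3, ← hz']
    have ea : u2 - v21 * s = a := by linear_combination ha2
    have eb : s * u1 + a - v31 * x = b := by linear_combination hc2 - hb2
    have ec : w2 - v31 * x' = c := by linear_combination hf2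
    rw [ea, eb, ec]
  · rw [Set.encard_coe_eq_coe_finsetCard]
    exact_mod_cast hr
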